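/- arXiv:2009.05270 — 2 statements merged into one kernel-verified Lean document; each statement's English description precedes it below -/
import Mathlib

section
/- Let F be a field, q ∈ F and f, g ∈ F[h]. Then the quantum generalized Heisenberg algebra H_q(f,g) is a domain (has no nonzero zero divisors) if and only if q ≠ 0 and deg f ≥ 1. -/
open Polynomial

/-- The three generators `x`, `y`, `h` of a quantum generalized Heisenberg algebra. -/
inductive QGHAGen : Type
  | x : QGHAGen
  | y : QGHAGen
  | h : QGHAGen

/-- The defining relations of the quantum generalized Heisenberg algebra `H_q(f,g)`:
`h*x = x*f(h)`, `y*h = f(h)*y`, and `y*x - q*(x*y) = g(h)`. -/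
inductive QGHARel (F : Type*) [Field F] (q : F) (f g : F[X]) :
    FreeAlgebra F QGHAGen → FreeAlgebra F QGHAGen → Prop
  | hx : QGHARel F q f g
      (FreeAlgebra.ι F QGHAGen.h * FreeAlgebra.ι F QGHAGen.x)
      (FreeAlgebra.ι F QGHAGen.x * aeval (FreeAlgebra.ι F QGHAGen.h) f)
  | yh : QGHARel F q f g
      (FreeAlgebra.ι F QGHAGen.y * FreeAlgebra.ι F QGHAGen.h)
      (aeval (FreeAlgebra.ι F QGHAGen.h) f * FreeAlgebra.ι F QGHAGen.y)
  | yx : QGHARel F q f g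
      (FreeAlgebra.ι F QGHAGen.y * FreeAlgebra.ι F QGHAGen.x)
      (q • (FreeAlgebra.ι F QGHAGen.x * FreeAlgebra.ι F QGHAGen.y)
        + aeval (FreeAlgebra.ι F QGHAGen.h) g)

/-- The quantum generalized Heisenberg algebra `H_q(f,g)`. -/
def QGHA (F : Type*) [Field F] (q : F) (f g : F[X]) : Type _ :=
  RingQuot (QGHARel F q f g)

namespace QGHA

variable {F : Type*} [Field F] (q : F) (f g : F[X])

instance : Ring (QGHA F q f g) :=
  inferInstanceAs (Ring (RingQuot (QGHARel F q f g)))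

instance : Algebra F (QGHA F q f g) :=
  inferInstanceAs (Algebra F (RingQuot (QGHARel F q f g)))

/-- The generator `x` of `H_q(f,g)`. -/
def x : QGHA F q f g :=
  RingQuot.mkAlgHom F (QGHARel F q f g) (FreeAlgebra.ι F QGHAGen.x)

/-- The generator `y` of `H_q(f,g)`. -/
def y : QGHA F q f g :=
  RingQuot.mkAlgHom F (QGHARel F q f g) (FreeAlgebra.ι F QGHAGen.y)

/-- The generator `h` of `H_q(f,g)`. -/
def h : QGHA F q f g :=
  RingQuot.mkAlgHom F (QGHARel F q f g) (FreeAlgebra.ι F QGHAGen.h)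

end QGHA

namespace QGHA

section Relations

variable {F : Type*} [Field F] (q : F) (f g : F[X])

/-- The quotient map onto `H_q(f,g)`. -/
def mk : FreeAlgebra F QGHAGen →ₐ[F] QGHA F q f g :=
  RingQuot.mkAlgHom F (QGHARel F q f g)

theorem mk_surjective : Function.Surjective (mk q f g) :=
  RingQuot.mkAlgHom_surjective F (QGHARel F q f g)

theorem mk_eq_of_rel {a b : FreeAlgebra F QGHAGen} (hab : QGHARel F q f g a b) :
    mk q f g a = mk q f g b :=
  RingQuot.mkAlgHom_rel F hab

theorem mk_aeval (p : F[X]) :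
    mk q f g (aeval (FreeAlgebra.ι F QGHAGen.h) p) = aeval (h q f g) p :=
  (aeval_algHom_apply (mk q f g) _ p).symm

theorem h_mul_x : h q f g * x q f g = x q f g * aeval (h q f g) f := by
  have := mk_eq_of_rel q f g .hx
  rw [map_mul, map_mul, mk_aeval] at this
  exact this

theorem y_mul_h : y q f g * h q f g = aeval (h q f g) f * y q f g := by
  have := mk_eq_of_rel q f g .yh
  rw [map_mul, map_mul, mk_aeval] at this
  exact this

theorem y_mul_x :
    y q f g * x q f g = q • (x q f g * y q f g) + aeval (h q f g) g := by
  have := mk_eq_of_rel q f g .yx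
  rw [map_mul, map_add, map_smul, map_mul, mk_aeval] at this
  exact this

theorem aeval_h_mul_x (p : F[X]) :
    aeval (h q f g) p * x q f g = x q f g * aeval (h q f g) (p.comp f) := by
  rw [aeval_comp]
  have hc : SemiconjBy (x q f g) (aeval (h q f g) f) (h q f g) := (h_mul_x q f g).symm
  induction p using Polynomial.induction_on' with
  | add p r hp hr => simp only [map_add, add_mul, mul_add, hp, hr]
  | monomial n a =>
    simp only [aeval_monomial]
    rw [mul_assoc, ← (hc.pow_right n).eq, ← mul_assoc, ← mul_assoc, Algebra.commutes]

theorem y_mul_aeval_h (p : F[X]) :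
    y q f g * aeval (h q f g) p = aeval (h q f g) (p.comp f) * y q f g := by
  rw [aeval_comp]
  have hc : SemiconjBy (y q f g) (h q f g) (aeval (h q f g) f) := y_mul_h q f g
  induction p using Polynomial.induction_on' with
  | add p r hp hr => simp only [map_add, add_mul, mul_add, hp, hr]
  | monomial n a =>
    simp only [aeval_monomial]
    rw [mul_assoc, ← (hc.pow_right n).eq, ← mul_assoc, ← mul_assoc, Algebra.commutes]

theorem aeval_h_mul_x_pow (p : F[X]) (i : ℕ) :
    ∃ r : F[X], aeval (h q f g) p * x q f g ^ i = x q f g ^ i * aeval (h q f g) r := by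
  induction i with
  | zero => exact ⟨p, by simp⟩
  | succ i ih =>
    obtain ⟨r, hr⟩ := ih
    exact ⟨r.comp f, by rw [pow_succ, ← mul_assoc, hr, mul_assoc, aeval_h_mul_x, mul_assoc]⟩

theorem y_mul_x_pow_succ (i : ℕ) :
    ∃ r : F[X], y q f g * x q f g ^ (i + 1)
      = q ^ (i + 1) • (x q f g ^ (i + 1) * y q f g) + x q f g ^ i * aeval (h q f g) r := by
  induction i with
  | zero => exact ⟨g, by simpa using y_mul_x q f g⟩
  | succ i ih =>
    obtain ⟨r, hr⟩ := ih
    refine ⟨q ^ (i + 1) • g + r.comp f, ?_⟩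
    rw [pow_succ (x q f g) (i + 1), ← mul_assoc, hr, add_mul, smul_mul_assoc, mul_assoc _ (y q f g),
      y_mul_x, mul_assoc _ _ (x q f g), aeval_h_mul_x, ← mul_assoc _ (x q f g), ← pow_succ, map_add,
      map_smul, mul_add, mul_add, smul_add, mul_smul_comm, mul_smul_comm, smul_smul, ← pow_succ,
      ← mul_assoc, add_assoc]

/-- The linear map sending a family of polynomials `p i j` to `∑ x ^ i * p i j (h) * y ^ j`. -/
noncomputable def ofCoeffs : (ℕ ×ₗ ℕ →₀ F[X]) →ₗ[F] QGHA F q f g :=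
  Finsupp.lsum F fun d ↦ LinearMap.mulLeft F (x q f g ^ (ofLex d).1) ∘ₗ
    LinearMap.mulRight F (y q f g ^ (ofLex d).2) ∘ₗ (aeval (h q f g)).toLinearMap

theorem ofCoeffs_single (d : ℕ ×ₗ ℕ) (p : F[X]) :
    ofCoeffs q f g (Finsupp.single d p)
      = x q f g ^ (ofLex d).1 * (aeval (h q f g) p * y q f g ^ (ofLex d).2) := by
  simp [ofCoeffs]

theorem monomial_mem_range (i j : ℕ) (p : F[X]) :
    x q f g ^ i * (aeval (h q f g) p * y q f g ^ j) ∈ LinearMap.range (ofCoeffs q f g) :=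
  ⟨Finsupp.single (toLex (i, j)) p, ofCoeffs_single ..⟩

theorem generator_mul_monomial_mem_range (t : QGHAGen) (i j : ℕ) (p : F[X]) :
    mk q f g (FreeAlgebra.ι F t) *
      (x q f g ^ i * (aeval (h q f g) p * y q f g ^ j)) ∈ LinearMap.range (ofCoeffs q f g) := by
  cases t with
  | x =>
    change x q f g * _ ∈ _
    rw [← mul_assoc, ← pow_succ']
    exact monomial_mem_range ..
  | h =>
    change h q f g * _ ∈ _
    obtain ⟨r, hr⟩ := aeval_h_mul_x_pow q f g X i
    rw [aeval_X] at hr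
    rw [← mul_assoc, hr, mul_assoc, ← mul_assoc (aeval _ r), ← map_mul]
    exact monomial_mem_range ..
  | y =>
    change y q f g * _ ∈ _
    have hy : y q f g * (aeval (h q f g) p * y q f g ^ j)
        = aeval (h q f g) (p.comp f) * y q f g ^ (j + 1) := by
      rw [← mul_assoc, y_mul_aeval_h, mul_assoc, ← pow_succ']
    cases i with
    | zero =>
      rw [pow_zero, one_mul, hy, ← one_mul (_ * _), ← pow_zero (x q f g)]
      exact monomial_mem_range ..
    | succ i =>
      obtain ⟨r, hr⟩ := y_mul_x_pow_succ q f g i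
      rw [← mul_assoc, hr, add_mul, smul_mul_assoc, mul_assoc _ (y q f g), hy, mul_assoc,
        ← mul_assoc (aeval _ r), ← map_mul]
      exact add_mem (Submodule.smul_mem _ _ (monomial_mem_range ..)) (monomial_mem_range ..)

theorem mul_mem_range (w : FreeAlgebra F QGHAGen) :
    ∀ a ∈ LinearMap.range (ofCoeffs q f g),
      mk q f g w * a ∈ LinearMap.range (ofCoeffs q f g) := by
  induction w using FreeAlgebra.induction with
  | grade0 r =>
    intro a ha
    rw [AlgHom.commutes]
    exact (Algebra.smul_def r a) ▸ Submodule.smul_mem _ r ha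
  | grade1 t =>
    rintro _ ⟨m, rfl⟩
    induction m using Finsupp.induction_linear with
    | zero => rw [map_zero, mul_zero]; exact zero_mem _
    | add m n hm hn => rw [map_add, mul_add]; exact add_mem hm hn
    | single d p =>
      rw [ofCoeffs_single]
      exact generator_mul_monomial_mem_range ..
  | mul v w hv hw =>
    intro a ha
    rw [map_mul]
    exact mul_assoc _ _ a ▸ hv _ (hw a ha)
  | add v w hv hw =>
    intro a ha
    rw [map_add]
    exact add_mul _ _ a ▸ add_mem (hv a ha) (hw a ha)

theorem ofCoeffs_surjective : Function.Surjective (ofCoeffs q f g) := by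
  intro a
  obtain ⟨w, rfl⟩ := mk_surjective q f g a
  have h1 := monomial_mem_range q f g 0 0 1
  simp only [pow_zero, map_one, mul_one] at h1
  have := mul_mem_range q f g w 1 h1
  rwa [mul_one] at this

end Relations

section Representation

variable {F : Type*} [Field F] (q : F) (f g : F[X])

/-- The action of `x`: on the coefficients of `∑ x ^ k * v k l (h) * y ^ l`, a shift. -/
noncomputable def xOp : Module.End F (ℕ → ℕ → F[X]) where
  toFun v
    | 0 => 0
    | k + 1 => v k
  map_add' u v := by
    funext k
    cases k <;> simp
  map_smul' a v := by
    funext k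
    cases k <;> simp

/-- The action of `h` on the coefficients of `∑ x ^ k * v k l (h) * y ^ l`. -/
noncomputable def hOp : Module.End F (ℕ → ℕ → F[X]) where
  toFun v k l := f.comp^[k] X * v k l
  map_add' u v := by
    funext k l
    simp [mul_add]
  map_smul' a v := by
    funext k l
    simp

/-- The polynomial `r k` such that `y * x ^ k = q ^ k • (x ^ k * y) + x ^ (k - 1) * r k (h)`. -/
noncomputable def commCoeff : ℕ → F[X]
  | 0 => 0
  | k + 1 => q • commCoeff k + g.comp (f.comp^[k] X)

/-- The part of the action of `y` which raises the degree in `y`. -/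
noncomputable def yTop (v : ℕ → ℕ → F[X]) (k : ℕ) : ℕ → F[X]
  | 0 => 0
  | l + 1 => q ^ k • (v k l).comp f

/-- The action of `y` on the coefficients of `∑ x ^ k * v k l (h) * y ^ l`. -/
noncomputable def yOp : Module.End F (ℕ → ℕ → F[X]) where
  toFun v k l := yTop q f v k l + commCoeff q f g (k + 1) * v (k + 1) l
  map_add' u v := by
    funext k l
    cases l
    · simp [yTop, mul_add]
    · simp [yTop, mul_add, add_add_add_comm]
  map_smul' a v := by
    funext k l
    cases l <;> simp [yTop, smul_comm a]

theorem iterate_comp_comp (k : ℕ) : (f.comp^[k] X).comp f = f.comp^[k + 1] X := by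
  induction k with
  | zero => simp
  | succ k ih => rw [Function.iterate_succ_apply', comp_assoc, ih, Function.iterate_succ_apply' _ (k + 1)]

theorem aeval_hOp_apply (p : F[X]) (v : ℕ → ℕ → F[X]) (k l : ℕ) :
    aeval (hOp f) p v k l = p.comp (f.comp^[k] X) * v k l := by
  induction p using Polynomial.induction_on' with
  | add p r hp hr => simp [add_mul, hp, hr]
  | monomial n a =>
    have hpow : ∀ n, (hOp f ^ n) v k l = (f.comp^[k] X) ^ n * v k l := by
      intro n
      induction n with
      | zero => simp
      | succ n ih => simp [pow_succ', Module.End.mul_apply, mul_assoc, ← ih, hOp]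
    simp [aeval_monomial, Module.algebraMap_end_apply, hpow, smul_eq_C_mul, mul_assoc]

/-- The representation of `H_q(f,g)` on families of polynomials, modelled on its left regular
representation in terms of the normal forms `∑ x ^ k * v k l (h) * y ^ l`. -/
noncomputable def rep : QGHA F q f g →ₐ[F] Module.End F (ℕ → ℕ → F[X]) :=
  RingQuot.liftAlgHom F ⟨FreeAlgebra.lift F fun
    | .x => xOp
    | .y => yOp q f g
    | .h => hOp f, by
    intro a b hab
    cases hab with
    | hx =>
      simp only [map_mul, ← aeval_algHom_apply, FreeAlgebra.lift_ι_apply]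
      ext v k l : 3
      cases k with
      | zero => simp [Module.End.mul_apply, xOp, hOp]
      | succ k =>
        simp only [Module.End.mul_apply]
        change f.comp^[k + 1] X * v k l = aeval (hOp f) f v k l
        rw [aeval_hOp_apply, Function.iterate_succ_apply']
    | yh =>
      simp only [map_mul, ← aeval_algHom_apply, FreeAlgebra.lift_ι_apply]
      ext v k l : 3
      rw [Module.End.mul_apply, Module.End.mul_apply, aeval_hOp_apply,
        ← Function.iterate_succ_apply' f.comp k X]
      cases l <;> simp [yOp, yTop, hOp, ← iterate_comp_comp, smul_eq_C_mul] <;> ring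
    | yx =>
      simp only [map_mul, map_add, map_smul, ← aeval_algHom_apply, FreeAlgebra.lift_ι_apply]
      ext v k l : 3
      simp only [Module.End.mul_apply, LinearMap.add_apply, LinearMap.smul_apply, Pi.add_apply,
        Pi.smul_apply, aeval_hOp_apply]
      cases k <;> cases l <;>
        simp [yOp, yTop, xOp, commCoeff, pow_succ', mul_smul, add_mul, add_assoc]⟩

theorem rep_x : rep q f g (x q f g) = xOp :=
  (RingQuot.liftAlgHom_mkAlgHom_apply ..).trans (FreeAlgebra.lift_ι_apply ..)

theorem rep_y : rep q f g (y q f g) = yOp q f g :=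
  (RingQuot.liftAlgHom_mkAlgHom_apply ..).trans (FreeAlgebra.lift_ι_apply ..)

theorem rep_h : rep q f g (h q f g) = hOp f :=
  (RingQuot.liftAlgHom_mkAlgHom_apply ..).trans (FreeAlgebra.lift_ι_apply ..)

theorem rep_aeval_h (p : F[X]) : rep q f g (aeval (h q f g) p) = aeval (hOp f) p := by
  rw [← aeval_algHom_apply, rep_h]

/-- The coefficient family of `1`. -/
noncomputable def vacuum : ℕ → ℕ → F[X] :=
  Pi.single 0 (Pi.single 0 1)

theorem x_ne_zero : x q f g ≠ 0 := fun h0 ↦ by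
  have := congr_fun₂ (LinearMap.congr_fun (rep_x q f g) vacuum) 1 0
  simp [h0, xOp, vacuum] at this

theorem y_ne_zero : y q f g ≠ 0 := fun h0 ↦ by
  have := congr_fun₂ (LinearMap.congr_fun (rep_y q f g) vacuum) 0 1
  simp [h0, yOp, yTop, vacuum] at this

theorem aeval_h_ne_zero {p : F[X]} (hp : p ≠ 0) : aeval (h q f g) p ≠ 0 := fun h0 ↦ by
  have := congr_fun₂ (LinearMap.congr_fun (rep_aeval_h q f g p) vacuum) 0 0
  rw [aeval_hOp_apply] at this
  simp [h0, vacuum] at this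
  exact hp this.symm

end Representation

section LeadingTerm

variable {F : Type*} [Field F] {q : F} {f : F[X]} (g : F[X])

/-- The lexicographically largest position of a nonzero coefficient of `v` is `d`. -/
def IsLeading (v : ℕ → ℕ → F[X]) (d : ℕ ×ₗ ℕ) : Prop :=
  v (ofLex d).1 (ofLex d).2 ≠ 0 ∧ ∀ e : ℕ ×ₗ ℕ, d < e → v (ofLex e).1 (ofLex e).2 = 0

theorem isLeading_iff {v : ℕ → ℕ → F[X]} {k l : ℕ} :
    IsLeading v (toLex (k, l)) ↔
      v k l ≠ 0 ∧ ∀ k' l', k < k' ∨ k = k' ∧ l < l' → v k' l' = 0 := by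
  simp only [IsLeading, ofLex_toLex, Lex.forall, Prod.forall, Prod.Lex.toLex_lt_toLex]

theorem isLeading_vacuum : IsLeading (vacuum (F := F)) 0 := by
  change IsLeading _ (toLex (0, 0))
  rw [isLeading_iff]
  refine ⟨by simp [vacuum], fun k l hkl ↦ ?_⟩
  rcases hkl with hk | ⟨rfl, hl⟩
  · simp [vacuum, hk.ne']
  · simp [vacuum, hl.ne']

theorem IsLeading.xOp {v : ℕ → ℕ → F[X]} {k l : ℕ} (hv : IsLeading v (toLex (k, l))) :
    IsLeading (xOp v) (toLex (k + 1, l)) := by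
  rw [isLeading_iff] at hv ⊢
  refine ⟨hv.1, fun k' l' hkl ↦ ?_⟩
  cases k' with
  | zero => rfl
  | succ k' => exact hv.2 k' l' (by lia)

theorem comp_ne_zero_of_natDegree_ne_zero {p r : F[X]} (hp : p ≠ 0) (hr : r.natDegree ≠ 0) :
    p.comp r ≠ 0 := by
  rw [Ne, comp_eq_zero_iff, not_or]
  exact ⟨hp, fun h0 ↦ hr (h0.2 ▸ natDegree_C _)⟩

theorem IsLeading.yOp (hq : q ≠ 0) (hf : f.natDegree ≠ 0) {v : ℕ → ℕ → F[X]} {k l : ℕ}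
    (hv : IsLeading v (toLex (k, l))) : IsLeading (yOp q f g v) (toLex (k, l + 1)) := by
  rw [isLeading_iff] at hv ⊢
  have hval (k l) : QGHA.yOp q f g v k l = yTop q f v k l + commCoeff q f g (k + 1) * v (k + 1) l :=
    rfl
  constructor
  · rw [hval, hv.2 (k + 1) _ (by lia), mul_zero, add_zero]
    exact smul_ne_zero (pow_ne_zero _ hq) (comp_ne_zero_of_natDegree_ne_zero hv.1 hf)
  · intro k' l' hkl
    rw [hval, hv.2 (k' + 1) _ (by lia), mul_zero, add_zero]
    cases l' with
    | zero => rfl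
    | succ l' => simp [yTop, hv.2 k' l' (by lia)]

theorem IsLeading.aeval_hOp (hf : f.natDegree ≠ 0) {p : F[X]} (hp : p ≠ 0) {v : ℕ → ℕ → F[X]}
    {d : ℕ ×ₗ ℕ} (hv : IsLeading v d) : IsLeading (aeval (hOp f) p v) d := by
  refine ⟨?_, fun e he ↦ ?_⟩
  · rw [aeval_hOp_apply]
    refine mul_ne_zero (comp_ne_zero_of_natDegree_ne_zero hp ?_) hv.1
    simp [natDegree_iterate_comp, hf]
  · rw [aeval_hOp_apply, hv.2 e he, mul_zero]

theorem IsLeading.monomial (hq : q ≠ 0) (hf : f.natDegree ≠ 0) {p : F[X]} (hp : p ≠ 0)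
    {v : ℕ → ℕ → F[X]} {e : ℕ ×ₗ ℕ} (hv : IsLeading v e) (d : ℕ ×ₗ ℕ) :
    IsLeading (rep q f g (x q f g ^ (ofLex d).1 *
      (aeval (h q f g) p * y q f g ^ (ofLex d).2)) v) (d + e) := by
  obtain ⟨i, j⟩ := d
  obtain ⟨k, l⟩ := e
  change IsLeading (rep q f g (x q f g ^ i * (aeval (h q f g) p * y q f g ^ j)) v)
    (toLex (i + k, j + l))
  change IsLeading v (toLex (k, l)) at hv
  rw [map_mul, map_mul, map_pow, map_pow, rep_x, rep_y, rep_aeval_h, Module.End.mul_apply,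
    Module.End.mul_apply]
  have hy : IsLeading ((QGHA.yOp q f g ^ j) v) (toLex (k, j + l)) := by
    induction j with
    | zero => simpa only [pow_zero, zero_add, Module.End.one_apply] using hv
    | succ j ih => simpa [pow_succ', add_right_comm] using ih.yOp g hq hf
  have hh := hy.aeval_hOp hf hp
  induction i with
  | zero => simpa only [pow_zero, zero_add, Module.End.one_apply] using hh
  | succ i ih => simpa [pow_succ', add_right_comm] using ih.xOp

theorem exists_isLeading_rep (hq : q ≠ 0) (hf : f.natDegree ≠ 0) {a : QGHA F q f g} (ha : a ≠ 0)
    {v : ℕ → ℕ → F[X]} {e : ℕ ×ₗ ℕ} (hv : IsLeading v e) :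
    ∃ d, IsLeading (rep q f g a v) d := by
  obtain ⟨m, rfl⟩ := ofCoeffs_surjective q f g a
  have hm : m.support.Nonempty := by
    rw [Finsupp.support_nonempty_iff]
    rintro rfl
    exact ha (map_zero _)
  have hsum (k l : ℕ) : rep q f g (ofCoeffs q f g m) v k l
      = ∑ d ∈ m.support, rep q f g (x q f g ^ (ofLex d).1 *
        (aeval (h q f g) (m d) * y q f g ^ (ofLex d).2)) v k l := by
    conv_lhs => rw [← Finsupp.sum_single m, Finsupp.sum]
    simp only [map_sum, LinearMap.sum_apply, Finset.sum_apply, ofCoeffs_single]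
  have hlead (d) (hd : d ∈ m.support) :=
    hv.monomial g hq hf (Finsupp.mem_support_iff.mp hd) d
  refine ⟨m.support.max' hm + e, ?_, fun c hc ↦ ?_⟩
  · rw [hsum, Finset.sum_eq_single_of_mem _ (m.support.max'_mem hm)]
    · exact (hlead _ (m.support.max'_mem hm)).1
    · intro d hd hne
      exact (hlead d hd).2 _ (by gcongr; exact lt_of_le_of_ne (m.support.le_max' d hd) hne)
  · rw [hsum]
    refine Finset.sum_eq_zero fun d hd ↦ (hlead d hd).2 _ (lt_of_le_of_lt ?_ hc)
    gcongr
    exact m.support.le_max' d hd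

end LeadingTerm

section Domain

variable {F : Type*} [Field F] {q : F} {f : F[X]} (g : F[X])

theorem isDomain (hq : q ≠ 0) (hf : f.natDegree ≠ 0) : IsDomain (QGHA F q f g) := by
  have : Nontrivial (QGHA F q f g) := ⟨x q f g, 0, x_ne_zero q f g⟩
  have : NoZeroDivisors (QGHA F q f g) := by
    refine ⟨fun {a b} hab ↦ ?_⟩
    by_contra! hne
    obtain ⟨d, hd⟩ := exists_isLeading_rep g hq hf hne.2 isLeading_vacuum
    obtain ⟨e, he⟩ := exists_isLeading_rep g hq hf hne.1 hd
    rw [← Module.End.mul_apply, ← map_mul, hab, map_zero] at he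
    exact he.1 rfl
  exact NoZeroDivisors.to_isDomain _

theorem exists_dvd_comp (f : F[X]) {g : F[X]} (hg : g ≠ 0) : ∃ r : F[X], r ≠ 0 ∧ g ∣ r.comp f := by
  have : Module.Finite F (AdjoinRoot g) := (AdjoinRoot.powerBasis hg).finite
  have hint : IsIntegral F (AdjoinRoot.mk g f) := .of_finite F _
  refine ⟨minpoly F (AdjoinRoot.mk g f), minpoly.ne_zero hint, ?_⟩
  rw [← AdjoinRoot.mk_eq_zero, comp_eq_aeval, ← AdjoinRoot.mkₐ_toRingHom]
  change AdjoinRoot.mkₐ g _ = 0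
  rw [← aeval_algHom_apply]
  exact minpoly.aeval F _

theorem not_isDomain_of_q_eq_zero (f : F[X]) : ¬ IsDomain (QGHA F 0 f g) := by
  intro hdom
  have hyx := y_mul_x 0 f g
  rw [zero_smul, zero_add] at hyx
  by_cases hg : g = 0
  · rw [hg, map_zero] at hyx
    rcases mul_eq_zero.mp (hg ▸ hyx) with h0 | h0
    · exact y_ne_zero _ _ _ h0
    · exact x_ne_zero _ _ _ h0
  obtain ⟨r, hr, p, hp⟩ := exists_dvd_comp f hg
  have hmul : y 0 f g * (x 0 f g * (aeval (h 0 f g) p * y 0 f g) - aeval (h 0 f g) r) = 0 := by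
    rw [mul_sub, ← mul_assoc, hyx, y_mul_aeval_h, hp, map_mul, mul_assoc, sub_self]
  rcases mul_eq_zero.mp hmul with h0 | h0
  · exact y_ne_zero _ _ _ h0
  · have h1 := congr_fun₂ (LinearMap.congr_fun (congr_arg (rep 0 f g) h0) vacuum) 0 0
    simp only [map_sub, map_mul, rep_x, rep_aeval_h, LinearMap.sub_apply, Pi.sub_apply,
      Module.End.mul_apply, aeval_hOp_apply] at h1
    simp [xOp, vacuum, hr] at h1

theorem not_isDomain_C (q c : F) : ¬ IsDomain (QGHA F q (C c) g) := by
  intro hdom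
  have hmul : aeval (h q (C c) g) (X - C c) * x q (C c) g = 0 := by
    rw [aeval_h_mul_x]
    simp
  rcases mul_eq_zero.mp hmul with h0 | h0
  · exact aeval_h_ne_zero _ _ _ (X_sub_C_ne_zero c) h0
  · exact x_ne_zero _ _ _ h0

end Domain

end QGHA

/-- `H_q(f,g)` is a domain (no nonzero zero divisors) if and only if
`q ≠ 0` and `deg f ≥ 1`. -/
theorem qgha_isDomain_iff {F : Type*} [Field F] (q : F) (f g : F[X]) :
    IsDomain (QGHA F q f g) ↔ (q ≠ 0 ∧ 1 ≤ f.degree) := by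
  have hdeg : 1 ≤ f.degree ↔ f.natDegree ≠ 0 := by
    rw [← Nat.pos_iff_ne_zero, natDegree_pos_iff_degree_pos, Nat.WithBot.one_le_iff_zero_lt]
  rw [hdeg]
  refine ⟨fun hdom ↦ ⟨?_, fun hf ↦ ?_⟩, fun hqf ↦ QGHA.isDomain g hqf.1 hqf.2⟩
  · rintro rfl
    exact QGHA.not_isDomain_of_q_eq_zero g f hdom
  · rw [eq_C_of_natDegree_eq_zero hf] at hdom
    exact QGHA.not_isDomain_C g q _ hdom
end

section
/- Let F be a field with F-algebra endomorphism σ of F[h] determined by σ(h) = f(h), where f ∈ F[h] has deg f > 1. Then the Gelfand–Kirillov dimension of the Ore extension (skew polynomial ring) F[h][y; σ] is at least 3. -/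
open Polynomial

/-- The two generators `h`, `y` of the Ore extension `F[h][y; σ]`. -/
inductive OreGen : Type
  | h : OreGen
  | y : OreGen

/-- The defining relation `y·h = f(h)·y` of the Ore extension `F[h][y; σ]`, where
`σ : F[h] → F[h]` is the `F`-algebra endomorphism with `σ(h) = f(h)`.  (The algebra
`F⟨h,y⟩/(y·h − f(h)·y)` has basis `{h^i y^j}` and is precisely the skew polynomial ring
`F[h][y; σ]`, with multiplication twisted by `y·p = σ(p)·y`.) -/
inductive OreRel (F : Type*) [Field F] (f : F[X]) :
    FreeAlgebra F OreGen → FreeAlgebra F OreGen → Prop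
  | yh : OreRel F f
      (FreeAlgebra.ι F OreGen.y * FreeAlgebra.ι F OreGen.h)
      (aeval (FreeAlgebra.ι F OreGen.h) f * FreeAlgebra.ι F OreGen.y)

/-- The Ore extension (skew polynomial ring) `F[h][y; σ]`, where `σ(h) = f(h)`. -/
def OreExt (F : Type*) [Field F] (f : F[X]) : Type _ :=
  RingQuot (OreRel F f)

instance {F : Type*} [Field F] (f : F[X]) : Ring (OreExt F f) :=
  inferInstanceAs (Ring (RingQuot (OreRel F f)))

instance {F : Type*} [Field F] (f : F[X]) : Algebra F (OreExt F f) :=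
  inferInstanceAs (Algebra F (RingQuot (OreRel F f)))

/-- The Gelfand–Kirillov dimension of an `F`-algebra `A`: the supremum over all
finite-dimensional subspaces `V ⊆ A` of `limsup_n log_n dim(V^n)`. -/
noncomputable def GKdim (F : Type*) (A : Type*) [Field F] [Ring A] [Algebra F A] : ENNReal :=
  ⨆ (V : Submodule F A) (_ : FiniteDimensional F V),
    Filter.limsup
      (fun n : ℕ => ENNReal.ofReal (Real.logb n (Module.finrank F ↥(V ^ n))))
      Filter.atTop

/-- Nonzero polynomials over a field with pairwise distinct degrees are linearly independent. -/
theorem linearIndependent_of_injective_natDegree {F ι : Type*} [Field F] (p : ι → F[X])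
    (hp : ∀ i, p i ≠ 0) (hinj : Function.Injective fun i => (p i).natDegree) :
    LinearIndependent F p := by
  rw [linearIndependent_iff']
  intro s g hg i hi
  by_contra hgi
  have hdeg : ∀ j, g j ≠ 0 → (g j • p j).degree = (p j).degree := fun j hj => by
    rw [smul_eq_C_mul, degree_C_mul hj]
  have hsum := degree_sum_eq_of_disjoint (fun j => g j • p j) s (by
    rintro a ⟨-, ha⟩ b ⟨-, hb⟩ hab hdab
    simp only [Function.comp_apply] at hdab
    rw [hdeg a (left_ne_zero_of_smul ha), hdeg b (left_ne_zero_of_smul hb)] at hdab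
    exact hab (hinj (natDegree_eq_of_degree_eq hdab)))
  rw [hg, degree_zero] at hsum
  have hle := Finset.le_sup (f := fun j => (g j • p j).degree) hi
  rw [← hsum, le_bot_iff, degree_eq_bot] at hle
  exact smul_ne_zero hgi (hp i) hle

/-- If a linear map to `F[X]` takes values of all degrees in `S` on `W`, then `dim W ≥ |S|`. -/
theorem card_le_finrank_of_natDegree {F A : Type*} [Field F] [AddCommGroup A] [Module F A]
    (φ : A →ₗ[F] F[X]) (W : Submodule F A) [FiniteDimensional F W] (S : Finset ℕ)
    (hS : ∀ s ∈ S, ∃ a ∈ W, φ a ≠ 0 ∧ (φ a).natDegree = s) :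
    S.card ≤ Module.finrank F W := by
  choose! v hvW hv0 hvdeg using hS
  let w : S → W := fun s => ⟨v s, hvW s s.2⟩
  have hw : LinearIndependent F w := by
    apply LinearIndependent.of_comp (φ ∘ₗ W.subtype)
    apply linearIndependent_of_injective_natDegree
    · exact fun s => hv0 s s.2
    · intro s t hst
      apply Subtype.ext
      rw [← hvdeg s s.2, ← hvdeg t t.2]
      exact hst
  simpa using hw.fintype_card_le_finrank

namespace OreExt

variable {F : Type*} [Field F] (f : F[X])

/-- The image in the Ore extension of a generator. -/
noncomputable def gen (x : OreGen) : OreExt F f :=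
  RingQuot.mkAlgHom F (OreRel F f) (FreeAlgebra.ι F x)

/-- The operators on `F[X]` representing the generators: `h` acts by multiplication by `X`,
and `y` by composition with `f`. -/
noncomputable def genAction : OreGen → Module.End F F[X]
  | .h => Algebra.lmul F F[X] X
  | .y => (aeval f).toLinearMap

/-- The natural representation of `F[h][y; σ]` on `F[X]`. -/
noncomputable def action : OreExt F f →ₐ[F] Module.End F F[X] :=
  RingQuot.liftAlgHom F ⟨FreeAlgebra.lift F (genAction f), by
    rintro _ _ ⟨⟩
    have hf : aeval (Algebra.lmul F F[X] X) f = Algebra.lmul F F[X] f := by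
      rw [aeval_algHom_apply, aeval_X_left_apply]
    rw [map_mul, map_mul, ← aeval_algHom_apply, FreeAlgebra.lift_ι_apply,
      FreeAlgebra.lift_ι_apply]
    refine LinearMap.ext fun p => ?_
    change aeval f (X * p) = aeval (Algebra.lmul F F[X] X) f (aeval f p)
    rw [hf, map_mul, aeval_X]
    rfl⟩

theorem action_gen (x : OreGen) : action f (gen f x) = genAction f x := by
  rw [action, gen]
  erw [RingQuot.liftAlgHom_mkAlgHom_apply]
  exact FreeAlgebra.lift_ι_apply _ _

theorem action_h (p : F[X]) : action f (gen f .h) p = X * p := by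
  rw [action_gen]; rfl

theorem action_y (p : F[X]) : action f (gen f .y) p = p.comp f := by
  rw [action_gen]; rfl

/-- The linear map `F[h][y; σ] → F[X]` given by acting on `1`. -/
noncomputable def orbitMap : OreExt F f →ₗ[F] F[X] :=
  LinearMap.applyₗ (1 : F[X]) ∘ₗ (action f).toLinearMap

theorem orbitMap_y_mul (a : OreExt F f) :
    orbitMap f (gen f .y * a) = (orbitMap f a).comp f := by
  simp [orbitMap, action_y]

theorem orbitMap_h_mul (a : OreExt F f) :
    orbitMap f (gen f .h * a) = X * orbitMap f a := by
  simp [orbitMap, action_h]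

theorem orbitMap_one : orbitMap f 1 = 1 := by
  simp [orbitMap]

/-- The span of `y` and `hy`. -/
noncomputable def freeSpan : Submodule F (OreExt F f) :=
  Submodule.span F {gen f .y, gen f .h * gen f .y}

theorem fg_freeSpan : (freeSpan f).FG :=
  Submodule.fg_span (Set.toFinite _)

variable {f}

/-- The products of `n` factors from `{y, hy}` map to polynomials of `2 ^ n` distinct degrees. -/
theorem exists_degrees (hf : 1 < f.natDegree) (n : ℕ) :
    ∃ S : Finset ℕ, S.card = 2 ^ n ∧ ∀ s ∈ S, ∃ a ∈ freeSpan f ^ n,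
      orbitMap f a ≠ 0 ∧ (orbitMap f a).natDegree = s := by
  induction n with
  | zero =>
    refine ⟨{0}, rfl, fun s hs => ⟨1, ?_, ?_, ?_⟩⟩
    · simp [← Submodule.one_le]
    · simp [orbitMap_one]
    · simp_all [orbitMap_one]
  | succ n ih =>
    obtain ⟨S, hcard, hS⟩ := ih
    set d := f.natDegree
    have hcomp : ∀ p : F[X], p ≠ 0 → p.comp f ≠ 0 := fun p hp h0 => by
      rcases comp_eq_zero_iff.1 h0 with h | ⟨-, h⟩
      · exact hp h
      · have : d = 0 := by simpa [d] using congrArg natDegree h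
        omega
    refine ⟨S.image (· * d) ∪ S.image (· * d + 1), ?_, ?_⟩
    · rw [Finset.card_union_of_disjoint, Finset.card_image_of_injective,
        Finset.card_image_of_injective, hcard, pow_succ, mul_two]
      · intro a b hab
        exact Nat.eq_of_mul_eq_mul_right (by omega) (Nat.succ_injective hab)
      · intro a b hab
        exact Nat.eq_of_mul_eq_mul_right (by omega) hab
      · rw [Finset.disjoint_left]
        simp only [Finset.mem_image, not_exists, not_and]
        rintro _ ⟨a, -, rfl⟩ b - hab
        have := congrArg (· % d) hab
        simp [Nat.add_mod, Nat.mod_eq_of_lt hf] at this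
    · intro s hs
      rw [pow_succ']
      simp only [Finset.mem_union, Finset.mem_image] at hs
      rcases hs with ⟨t, ht, rfl⟩ | ⟨t, ht, rfl⟩ <;> obtain ⟨a, ha, ha0, rfl⟩ := hS t ht
      · refine ⟨gen f .y * a, Submodule.mul_mem_mul (Submodule.subset_span (by simp)) ha, ?_⟩
        rw [orbitMap_y_mul]
        exact ⟨hcomp _ ha0, natDegree_comp⟩
      · refine ⟨gen f .h * gen f .y * a,
          Submodule.mul_mem_mul (Submodule.subset_span (by simp)) ha, ?_⟩
        rw [mul_assoc, orbitMap_h_mul, orbitMap_y_mul, natDegree_X_mul (hcomp _ ha0),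
          natDegree_comp]
        exact ⟨mul_ne_zero X_ne_zero (hcomp _ ha0), rfl⟩

theorem two_pow_le_finrank (hf : 1 < f.natDegree) (n : ℕ) :
    2 ^ n ≤ Module.finrank F ↥(freeSpan f ^ n) := by
  obtain ⟨S, hcard, hS⟩ := exists_degrees hf n
  have : FiniteDimensional F ↥(freeSpan f ^ n) :=
    Module.Finite.iff_fg.2 ((fg_freeSpan f).pow n)
  rw [← hcard]
  exact card_le_finrank_of_natDegree (orbitMap f) _ S hS

end OreExt

theorem Nat.pow_three_le_two_pow {n : ℕ} (hn : 10 ≤ n) : n ^ 3 ≤ 2 ^ n := by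
  induction n, hn using Nat.le_induction with
  | base => norm_num
  | succ n hn ih =>
    rw [pow_succ 2]
    nlinarith [Nat.mul_le_mul hn hn, Nat.mul_le_mul_right (n * n) hn, Nat.mul_le_mul_right n hn]

/-- If `deg f > 1` then the Gelfand–Kirillov dimension of the Ore
extension `F[h][y; σ]`, where `σ(h) = f(h)`, is at least `3`. -/
theorem oreExt_GKdim_ge_three {F : Type*} [Field F] (f : F[X]) (hf : 1 < f.degree) :
    3 ≤ GKdim F (OreExt F f) := by
  have hd : 1 < f.natDegree := by
    by_contra! h
    exact absurd (hf.trans_le (degree_le_of_natDegree_le h)) (lt_irrefl _)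
  refine le_iSup₂_of_le (OreExt.freeSpan f)
    (Module.Finite.iff_fg.2 (OreExt.fg_freeSpan f)) ?_
  apply Filter.le_limsup_of_frequently_le'
  apply Filter.Eventually.frequently
  filter_upwards [Filter.eventually_ge_atTop 10] with n hn
  have hn1 : (1 : ℝ) < n := by exact_mod_cast (by omega : 1 < n)
  have hle : (n : ℝ) ^ 3 ≤ Module.finrank F ↥(OreExt.freeSpan f ^ n) := by
    exact_mod_cast (Nat.pow_three_le_two_pow hn).trans (OreExt.two_pow_le_finrank hd n)
  have hlog : (3 : ℝ) ≤ Real.logb n (Module.finrank F ↥(OreExt.freeSpan f ^ n)) := by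
    rw [Real.le_logb_iff_rpow_le hn1 (lt_of_lt_of_le (by positivity) hle)]
    exact_mod_cast hle
  simpa using ENNReal.ofReal_le_ofReal hlog
end
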